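/- Fix n ≥ 1 and work in the polynomial ring ℤ[z₁,…,zₙ]. For each index i and each g ∈ {0,1,2} set w(i,0) = zᵢ³, w(i,1) = 2zᵢ², w(i,2) = 2zᵢ. Then the sum, over all weakly increasing functions v : {0,…,n} → ℤ with v(0)=0, v(n)=3 and v(i)−v(i−1) ≤ 2 for all i, of the products ∏_{i=1}^{n} w(i, v(i)−v(i−1)), equals 4·∑_{(j,k), j≠k} z_j z_k² ∏_{l∉{j,k}} z_l³ + 8·∑_{{i,j,k} a 3-element subset of {1,…,n}} z_i² z_j² z_k² ∏_{l∉{i,j,k}} z_l³. (This is the multidegree of the concurrent lines variety V_n in (P⁵)ⁿ, conjectured by Ponce–Sturmfels–Trager.) -/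

import Mathlib

open MvPolynomial

/-- The gap functions: `{0, 1, 2}`-valued functions on `Fin n` with total sum `3`. -/
noncomputable def gapFunctions (n : ℕ) : Finset (Fin n → ℤ) :=
  (Fintype.piFinset fun _ => Finset.Icc 0 2).filter fun g => ∑ i, g i = 3

theorem mem_gapFunctions {n : ℕ} {g : Fin n → ℤ} :
    g ∈ gapFunctions n ↔ (∀ i, 0 ≤ g i ∧ g i ≤ 2) ∧ ∑ i, g i = 3 := by
  simp [gapFunctions]

theorem eq_add_partialSum_sub {n : ℕ} (v : Fin (n + 1) → ℤ) (i : Fin (n + 1)) :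
    v i = v 0 + Fin.partialSum (fun i : Fin n => v i.succ - v i.castSucc) i := by
  induction i using Fin.induction with
  | zero => simp
  | succ i ih => rw [Fin.partialSum_succ, ← add_assoc, ← ih]; ring

theorem partialSum_last_eq_sum {n : ℕ} (g : Fin n → ℤ) :
    Fin.partialSum g (Fin.last n) = ∑ i, g i := by
  rw [Fin.partialSum, Fin.val_last, List.take_of_length_le (by simp), List.sum_ofFn]

theorem bijOn_gaps (n : ℕ) :
    Set.BijOn (fun (v : Fin (n + 1) → ℤ) (i : Fin n) => v i.succ - v i.castSucc)
      {v | Monotone v ∧ v 0 = 0 ∧ v (Fin.last n) = 3 ∧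
        ∀ i : Fin n, v i.succ - v i.castSucc ≤ 2}
      (gapFunctions n) := by
  refine ⟨?_, ?_, ?_⟩
  · rintro v ⟨hm, h0, h3, h2⟩
    refine mem_gapFunctions.2 ⟨fun i => ⟨sub_nonneg.2 (hm i.castSucc_le_succ), h2 i⟩, ?_⟩
    have h := eq_add_partialSum_sub v (Fin.last n)
    rw [partialSum_last_eq_sum] at h
    simpa [h0, h3] using h.symm
  · rintro v ⟨-, h0, -⟩ u ⟨-, h0', -⟩ h
    funext i
    simp only at h
    rw [eq_add_partialSum_sub v, eq_add_partialSum_sub u, h0, h0', h]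
  · intro g hg
    obtain ⟨hg, hs⟩ := mem_gapFunctions.1 hg
    have hd (i : Fin n) :
        Fin.partialSum g i.succ - Fin.partialSum g i.castSucc = g i := by
      rw [Fin.partialSum_succ]; ring
    refine ⟨Fin.partialSum g, ⟨?_, Fin.partialSum_zero g, ?_, ?_⟩, funext hd⟩
    · exact Fin.monotone_iff_le_succ.2 fun i => sub_nonneg.1 ((hd i).symm ▸ (hg i).1)
    · rw [partialSum_last_eq_sum, hs]
    · exact fun i => (hd i).symm ▸ (hg i).2

theorem card_one_add_two_mul_card_two {n : ℕ} {g : Fin n → ℤ} (hg : g ∈ gapFunctions n) :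
    (Finset.univ.filter fun i => g i = 1).card
      + 2 * (Finset.univ.filter fun i => g i = 2).card = 3 := by
  obtain ⟨hb, hs⟩ := mem_gapFunctions.1 hg
  have h : ∑ i, g i = ∑ i, ((if g i = 1 then 1 else 0) + 2 * (if g i = 2 then 1 else 0)) := by
    refine Finset.sum_congr rfl fun i _ => ?_
    have := hb i
    split_ifs <;> omega
  rw [Finset.sum_add_distrib, ← Finset.mul_sum, Finset.sum_boole, Finset.sum_boole, hs] at h
  exact_mod_cast h.symm

theorem sum_gapFunctions_of_exists_two {n : ℕ} {M : Type*} [AddCommMonoid M]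
    (f : (Fin n → ℤ) → M) :
    ∑ g ∈ (gapFunctions n).filter (fun g => ∃ i, g i = 2), f g
      = ∑ p ∈ Finset.univ.filter (fun p : Fin n × Fin n => p.1 ≠ p.2),
          f (fun i => if i = p.1 then 2 else if i = p.2 then 1 else 0) := by
  symm
  refine Finset.sum_bij (fun p _ i => if i = p.1 then 2 else if i = p.2 then 1 else 0)
    ?_ ?_ ?_ fun _ _ => rfl
  · rintro ⟨j, k⟩ hp
    have hjk : j ≠ k := by simpa using hp
    refine Finset.mem_filter.2 ⟨mem_gapFunctions.2 ⟨fun i => ?_, ?_⟩, j, by simp⟩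
    · dsimp only
      split_ifs <;> norm_num
    · have h (i : Fin n) : (if i = j then (2 : ℤ) else if i = k then 1 else 0)
          = (if i = j then 2 else 0) + (if i = k then 1 else 0) := by
        split_ifs <;> simp_all
      simp [h, Finset.sum_add_distrib]
  · rintro ⟨j, k⟩ hp ⟨j', k'⟩ hp' h
    have hj := congrFun h j
    have hk := congrFun h k
    simp only [Finset.mem_filter] at hp hp'
    grind
  · intro g hg
    obtain ⟨hg, i, hi⟩ := Finset.mem_filter.1 hg
    have hc := card_one_add_two_mul_card_two hg
    have hpos : 0 < (Finset.univ.filter fun i => g i = 2).card :=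
      Finset.card_pos.2 ⟨i, by simpa using hi⟩
    obtain ⟨j, hj⟩ := Finset.card_eq_one.1
      (show (Finset.univ.filter fun i => g i = 2).card = 1 by omega)
    obtain ⟨k, hk⟩ := Finset.card_eq_one.1
      (show (Finset.univ.filter fun i => g i = 1).card = 1 by omega)
    have hj' (i : Fin n) : g i = 2 ↔ i = j := by simpa using Finset.ext_iff.1 hj i
    have hk' (i : Fin n) : g i = 1 ↔ i = k := by simpa using Finset.ext_iff.1 hk i
    have hb := (mem_gapFunctions.1 hg).1
    refine ⟨(j, k), ?_, funext fun i => ?_⟩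
    · simp only [Finset.mem_filter, Finset.mem_univ, true_and]
      grind
    · have := hb i
      have := hj' i
      have := hk' i
      dsimp only
      split_ifs <;> grind

theorem sum_gapFunctions_of_not_exists_two {n : ℕ} {M : Type*} [AddCommMonoid M]
    (f : (Fin n → ℤ) → M) :
    ∑ g ∈ (gapFunctions n).filter (fun g => ¬ ∃ i, g i = 2), f g
      = ∑ s ∈ Finset.univ.powersetCard 3, f (fun i => if i ∈ s then 1 else 0) := by
  symm
  refine Finset.sum_bij (fun s _ i => if i ∈ s then 1 else 0) ?_ ?_ ?_ fun _ _ => rfl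
  · intro s hs
    have hs := (Finset.mem_powersetCard.1 hs).2
    refine Finset.mem_filter.2 ⟨mem_gapFunctions.2 ⟨fun i => ?_, ?_⟩, ?_⟩
    · split_ifs <;> norm_num
    · simp [hs]
    · rintro ⟨i, hi⟩
      dsimp only at hi
      split_ifs at hi <;> omega
  · intro s _ t _ h
    ext i
    have hi := congrFun h i
    split_ifs at hi <;> simp_all
  · intro g hg
    obtain ⟨hg, hi⟩ := Finset.mem_filter.1 hg
    push Not at hi
    have hc := card_one_add_two_mul_card_two hg
    rw [Finset.filter_false_of_mem (p := fun i => g i = 2) fun i _ => hi i] at hc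
    refine ⟨Finset.univ.filter fun i => g i = 1, by simpa using hc, funext fun i => ?_⟩
    have := (mem_gapFunctions.1 hg).1 i
    have := hi i
    simp only [Finset.mem_filter, Finset.mem_univ, true_and]
    split_ifs <;> omega

/-- The multidegree of the concurrent lines variety `V_n` in `(ℙ⁵)ⁿ`
(conjectured by Ponce–Sturmfels–Trager): summing, over all gap sequences `v`,
the products `∏ᵢ w(i, v i − v (i-1))` where `w(i,0) = zᵢ³`, `w(i,1) = 2zᵢ²`,
`w(i,2) = 2zᵢ`, yields
`4 ∑_{(j,k), j≠k} z_j z_k² ∏_{l∉{j,k}} z_l³ + 8 ∑_{{i,j,k}} z_i² z_j² z_k² ∏_{l∉{i,j,k}} z_l³`. -/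
theorem multidegree_concurrent_lines (n : ℕ) (hn : 1 ≤ n)
    (w : Fin n → ℤ → MvPolynomial (Fin n) ℤ)
    (hw0 : ∀ i, w i 0 = X i ^ 3)
    (hw1 : ∀ i, w i 1 = 2 * X i ^ 2)
    (hw2 : ∀ i, w i 2 = 2 * X i) :
    (∑ᶠ v ∈ {v : Fin (n + 1) → ℤ | Monotone v ∧ v 0 = 0 ∧ v (Fin.last n) = 3 ∧
        ∀ i : Fin n, v i.succ - v i.castSucc ≤ 2},
      ∏ i : Fin n, w i (v i.succ - v i.castSucc))
    = 4 * (∑ p ∈ Finset.univ.filter (fun p : Fin n × Fin n => p.1 ≠ p.2),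
        X p.1 * X p.2 ^ 2 * ∏ l ∈ ({p.1, p.2} : Finset (Fin n))ᶜ, X l ^ 3)
      + 8 * (∑ s ∈ Finset.univ.powersetCard 3,
        (∏ i ∈ s, X i ^ 2) * ∏ l ∈ sᶜ, X l ^ 3) := by
  rw [finsum_mem_eq_of_bijOn (g := fun g : Fin n → ℤ => ∏ i, w i (g i)) _ (bijOn_gaps n)
    fun _ _ => rfl, finsum_mem_coe_finset,
    ← Finset.sum_filter_add_sum_filter_not _ (fun g : Fin n → ℤ => ∃ i, g i = 2),
    sum_gapFunctions_of_exists_two, sum_gapFunctions_of_not_exists_two,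
    Finset.mul_sum, Finset.mul_sum]
  congr 1
  · refine Finset.sum_congr rfl fun p hp => ?_
    have hp : p.1 ≠ p.2 := (Finset.mem_filter.1 hp).2
    rw [← Finset.prod_mul_prod_compl {p.1, p.2}, Finset.prod_pair hp]
    beta_reduce
    rw [if_pos rfl, if_neg hp.symm, if_pos rfl, hw1, hw2]
    have h : ∏ l ∈ ({p.1, p.2} : Finset (Fin n))ᶜ,
        w l (if l = p.1 then 2 else if l = p.2 then 1 else 0)
          = ∏ l ∈ ({p.1, p.2} : Finset (Fin n))ᶜ, X l ^ 3 := by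
      refine Finset.prod_congr rfl fun l hl => ?_
      simp only [Finset.mem_compl, Finset.mem_insert, Finset.mem_singleton, not_or] at hl
      rw [if_neg hl.1, if_neg hl.2, hw0]
    rw [h]
    ring
  · refine Finset.sum_congr rfl fun s hs => ?_
    have hs := (Finset.mem_powersetCard.1 hs).2
    have h1 : ∏ i ∈ s, w i (if i ∈ s then 1 else 0) = 8 * ∏ i ∈ s, X i ^ 2 := by
      rw [Finset.prod_congr rfl fun i hi => by rw [if_pos hi, hw1], Finset.prod_mul_distrib,
        Finset.prod_const, hs]
      norm_num
    have h0 : ∏ i ∈ sᶜ, w i (if i ∈ s then 1 else 0) = ∏ i ∈ sᶜ, X i ^ 3 :=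
      Finset.prod_congr rfl fun i hi => by rw [if_neg (Finset.mem_compl.1 hi), hw0]
    rw [← Finset.prod_mul_prod_compl s, h1, h0, mul_assoc]
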